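/- arXiv:cs/0207068 — 11 statements merged into one kernel-verified Lean document; each statement's English description precedes it below -/
import Mathlib

section
/- If the signature Σ contains no unary function symbol of weight 0, then for every natural number n there are only finitely many ground terms of weight n. -/
inductive Term (σ : Type) (ar : σ → ℕ) : Type
  | mk : (g : σ) → (Fin (ar g) → Term σ ar) → Term σ ar

def Term.weight {σ : Type} {ar : σ → ℕ} (w : σ → ℕ) : Term σ ar → ℕ
  | .mk g args => w g + ∑ i, Term.weight w (args i)

def Term.count {σ : Type} {ar : σ → ℕ} [DecidableEq σ] (g : σ) : Term σ ar → ℕ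
  | .mk h args => (if h = g then 1 else 0) + ∑ i, Term.count g (args i)

def Term.depth {σ : Type} {ar : σ → ℕ} : Term σ ar → ℕ
  | .mk _ args => 1 + Finset.univ.sup fun i => Term.depth (args i)

inductive Term.Subterm {σ : Type} {ar : σ → ℕ} : Term σ ar → Term σ ar → Prop
  | refl (t : Term σ ar) : Term.Subterm t t
  | arg {s : Term σ ar} {g : σ} {args : Fin (ar g) → Term σ ar} (i : Fin (ar g)) :
      Term.Subterm s (args i) → Term.Subterm s (.mk g args)

inductive KBO {σ : Type} {ar : σ → ℕ} (w : σ → ℕ) (prec : σ → σ → Prop) :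
    Term σ ar → Term σ ar → Prop
  | of_weight {t s : Term σ ar} : Term.weight w s < Term.weight w t → KBO w prec t s
  | of_prec {g h : σ} {ts : Fin (ar g) → Term σ ar} {ss : Fin (ar h) → Term σ ar} :
      Term.weight w (Term.mk g ts) = Term.weight w (Term.mk h ss) → prec g h →
      KBO w prec (Term.mk g ts) (Term.mk h ss)
  | of_lex {g : σ} {ts ss : Fin (ar g) → Term σ ar} (i : Fin (ar g)) :
      Term.weight w (Term.mk g ts) = Term.weight w (Term.mk g ss) →
      (∀ j : Fin (ar g), j < i → ts j = ss j) →
      KBO w prec (ts i) (ss i) →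
      KBO w prec (Term.mk g ts) (Term.mk g ss)

def IsWeightFn {σ : Type} (ar w : σ → ℕ) : Prop :=
  (∀ a, ar a = 0 → 0 < w a) ∧
  ∀ f g, ar f = 1 → w f = 0 → ar g = 1 → w g = 0 → f = g

def CompatiblePrec {σ : Type} (ar w : σ → ℕ) (prec : σ → σ → Prop) : Prop :=
  ∀ f, ar f = 1 → w f = 0 → ∀ g, g ≠ f → prec f g

theorem Term.weight_pos {σ : Type} {ar w : σ → ℕ} (hconst : ∀ a, ar a = 0 → 0 < w a)
    (t : Term σ ar) : 0 < t.weight w := by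
  induction t with
  | mk g args ih =>
    rw [Term.weight]
    rcases Nat.eq_zero_or_pos (ar g) with h | h
    · exact Nat.add_pos_left (hconst g h) _
    · exact Nat.add_pos_right _ (Finset.sum_pos (fun i _ => ih i) ⟨⟨0, h⟩, Finset.mem_univ _⟩)

theorem Term.weight_arg_lt {σ : Type} {ar w : σ → ℕ} (hconst : ∀ a, ar a = 0 → 0 < w a)
    (hunary : ∀ f, ar f = 1 → w f ≠ 0) {g : σ} (args : Fin (ar g) → Term σ ar) (i : Fin (ar g)) :
    (args i).weight w < (Term.mk g args).weight w := by
  rw [Term.weight]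
  by_cases h : ar g = 1
  · have hle : (args i).weight w ≤ ∑ j, (args j).weight w :=
      Finset.single_le_sum (f := fun j => (args j).weight w) (fun _ _ => Nat.zero_le _)
        (Finset.mem_univ i)
    have := hunary g h
    omega
  · have : Nontrivial (Fin (ar g)) := Fin.nontrivial_iff_two_le.2 (by have := i.pos; omega)
    obtain ⟨j, hj⟩ := exists_ne i
    have hlt : (args i).weight w < ∑ k, (args k).weight w :=
      Finset.single_lt_sum (f := fun k => (args k).weight w) hj (Finset.mem_univ i)
        (Finset.mem_univ j) (Term.weight_pos hconst _) (fun _ _ _ => Nat.zero_le _)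
    omega

theorem finitely_many_terms_of_weight {σ : Type} [Fintype σ] (ar w : σ → ℕ)
    (hconst : ∃ c, ar c = 0) (hw : IsWeightFn ar w)
    (hno : ∀ f, ar f = 1 → w f ≠ 0) (n : ℕ) :
    {t : Term σ ar | Term.weight w t = n}.Finite := by
  induction n using Nat.strong_induction_on with
  | _ n ih =>
    have hlt : {s : Term σ ar | s.weight w < n}.Finite := by
      have h : {s : Term σ ar | s.weight w < n} = ⋃ m ∈ Set.Iio n, {s | s.weight w = m} := by
        ext s
        simp
      rw [h]
      exact (Set.finite_Iio n).biUnion ih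
    refine (Set.finite_iUnion fun g =>
      (Set.Finite.pi' fun _ : Fin (ar g) => hlt).image (Term.mk g)).subset ?_
    rintro ⟨g, args⟩ ht
    refine Set.mem_iUnion.2 ⟨g, args, fun i => ?_, rfl⟩
    exact (Term.weight_arg_lt hw.1 hno args i).trans_eq ht
end

section
/- For every weight function w on Σ and every precedence ≫ compatible with w, the Knuth-Bendix order ≻ is a strict total order on the set of ground terms of Σ: it is irreflexive, transitive, and for any two distinct ground terms s, t either s ≻ t or t ≻ s. -/
theorem KBO.mk_iff {σ : Type} {ar w : σ → ℕ} {prec : σ → σ → Prop} {g h : σ}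
    {ts : Fin (ar g) → Term σ ar} {ss : Fin (ar h) → Term σ ar} :
    KBO w prec (.mk g ts) (.mk h ss) ↔
      Term.weight w (.mk h ss) < Term.weight w (.mk g ts) ∨
      Term.weight w (.mk g ts) = Term.weight w (.mk h ss) ∧
        (prec g h ∨ ∃ e : g = h, ∃ i : Fin (ar g),
          (∀ j < i, ts j = ss (j.cast (congrArg ar e))) ∧
            KBO w prec (ts i) (ss (i.cast (congrArg ar e)))) := by
  constructor
  · intro H
    cases H with
    | of_weight hlt => exact .inl hlt
    | of_prec heq hgh => exact .inr ⟨heq, .inl hgh⟩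
    | of_lex i heq hpre hi => exact .inr ⟨heq, .inr ⟨rfl, i, hpre, hi⟩⟩
  · rintro (hlt | ⟨heq, hgh | ⟨rfl, i, hpre, hi⟩⟩)
    · exact .of_weight hlt
    · exact .of_prec heq hgh
    · exact .of_lex i heq hpre hi

theorem KBO.irrefl {σ : Type} {ar w : σ → ℕ} {prec : σ → σ → Prop}
    (hprec : ∀ g, ¬ prec g g) (t : Term σ ar) : ¬ KBO w prec t t := by
  induction t with
  | mk g ts ih =>
    rw [KBO.mk_iff]
    rintro (hlt | ⟨-, hgg | ⟨_, i, -, hi⟩⟩)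
    · exact lt_irrefl _ hlt
    · exact hprec g hgg
    · exact ih i hi

theorem KBO.trans {σ : Type} {ar w : σ → ℕ} {prec : σ → σ → Prop}
    (hprec : ∀ f g h, prec f g → prec g h → prec f h) {t s r : Term σ ar}
    (hts : KBO w prec t s) (hsr : KBO w prec s r) : KBO w prec t r := by
  induction t generalizing s r with
  | mk f ts ih =>
    obtain ⟨g, ss⟩ := s
    obtain ⟨h, rs⟩ := r
    rw [KBO.mk_iff] at hts hsr
    rcases hts with hts | ⟨ets, hts⟩
    · rcases hsr with hsr | ⟨esr, -⟩
      · exact .of_weight (hsr.trans hts)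
      · exact .of_weight (esr ▸ hts)
    rcases hsr with hsr | ⟨esr, hsr⟩
    · exact .of_weight (ets ▸ hsr)
    have etr := ets.trans esr
    rcases hts with hfg | ⟨rfl, i, hi, hti⟩ <;> rcases hsr with hgh | ⟨rfl, j, hj, hsj⟩
    · exact .of_prec etr (hprec _ _ _ hfg hgh)
    · exact .of_prec etr hfg
    · exact .of_prec etr hgh
    · simp only [Fin.cast_eq_self] at hi hti hj hsj
      rcases lt_trichotomy i j with hij | rfl | hji
      · exact .of_lex i etr (fun k hk => (hi k hk).trans (hj k (hk.trans hij))) (hj i hij ▸ hti)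
      · exact .of_lex i etr (fun k hk => (hi k hk).trans (hj k hk)) (ih i hti hsj)
      · exact .of_lex j etr (fun k hk => (hi k (hk.trans hji)).trans (hj k hk))
          ((hi j hji).symm ▸ hsj)

theorem KBO.total_of_ne {σ : Type} {ar w : σ → ℕ} {prec : σ → σ → Prop}
    (hprec : ∀ g h, g ≠ h → prec g h ∨ prec h g) {s t : Term σ ar} (hne : s ≠ t) :
    KBO w prec s t ∨ KBO w prec t s := by
  induction s generalizing t with
  | mk g ss ih =>
    obtain ⟨h, ts⟩ := t
    rcases lt_trichotomy (Term.weight w (.mk g ss)) (Term.weight w (.mk h ts)) with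
      hlt | heq | hgt
    · exact .inr (.of_weight hlt)
    · by_cases hgh : g = h
      · subst hgh
        have hdiff : ∃ i, ss i ≠ ts i := by
          by_contra! hall
          exact hne (congrArg (Term.mk g) (funext hall))
        obtain ⟨i, hi, hmin⟩ := WellFounded.has_min (wellFounded_lt (α := Fin (ar g)))
          {i | ss i ≠ ts i} hdiff
        have hpre : ∀ j < i, ss j = ts j := fun j hj => by_contra fun hj' => hmin j hj' hj
        exact (ih i hi).imp (.of_lex i heq hpre)
          (.of_lex i heq.symm fun j hj => (hpre j hj).symm)
      · exact (hprec g h hgh).imp (.of_prec heq) (.of_prec heq.symm)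
    · exact .inl (.of_weight hgt)

theorem kbo_strict_total {σ : Type} [Fintype σ] (ar w : σ → ℕ) (prec : σ → σ → Prop)
    (hconst : ∃ c, ar c = 0) (hw : IsWeightFn ar w)
    (hprec : IsStrictTotalOrder σ prec) (hcompat : CompatiblePrec ar w prec) :
    (∀ t : Term σ ar, ¬ KBO w prec t t) ∧
    (∀ t s r : Term σ ar, KBO w prec t s → KBO w prec s r → KBO w prec t r) ∧
    (∀ s t : Term σ ar, s ≠ t → KBO w prec s t ∨ KBO w prec t s) := by
  refine ⟨KBO.irrefl hprec.irrefl, fun _ _ _ => KBO.trans hprec.trans,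
    fun _ _ => KBO.total_of_ne fun g h hne => ?_⟩
  by_contra! hgh
  exact hne (hprec.trichotomous g h hgh.1 hgh.2)
end

section
/- For every weight function w on Σ and every precedence ≫ compatible with w, the Knuth-Bendix order ≻ is well-founded on the set of ground terms of Σ (there is no infinite strictly descending chain t₁ ≻ t₂ ≻ t₃ ≻ …). -/
namespace Term

variable {σ : Type} {ar w : σ → ℕ}

theorem weight_mk (g : σ) (ts : Fin (ar g) → Term σ ar) :
    (mk g ts).weight w = w g + ∑ i, (ts i).weight w := by
  rw [weight]

theorem weight_pos_s5 (hw : IsWeightFn ar w) (t : Term σ ar) : 0 < t.weight w := by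
  induction t with
  | mk g ts ih =>
    rw [weight_mk]
    rcases Nat.eq_zero_or_pos (ar g) with h | h
    · exact Nat.add_pos_left (hw.1 g h) _
    · exact Nat.add_pos_right _ (Finset.sum_pos (fun i _ => ih i) ⟨⟨0, h⟩, Finset.mem_univ _⟩)

/-- Only a unary symbol of weight zero can have an argument as heavy as the whole term. -/
theorem weight_arg_lt_s5 (hw : IsWeightFn ar w) {g : σ} (hg : ¬(ar g = 1 ∧ w g = 0))
    (ts : Fin (ar g) → Term σ ar) (i : Fin (ar g)) :
    (ts i).weight w < (mk g ts).weight w := by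
  rw [weight_mk]
  by_cases h : ar g = 1
  · have hsum := Finset.single_le_sum (f := fun j => (ts j).weight w)
      (fun j _ => Nat.zero_le _) (Finset.mem_univ i)
    have : w g ≠ 0 := fun h0 => hg ⟨h, h0⟩
    omega
  · have : Nontrivial (Fin (ar g)) := Fin.nontrivial_iff_two_le.2 (by have := i.2; omega)
    obtain ⟨j, hj⟩ := exists_ne i
    have hlt := Finset.single_lt_sum (f := fun j => (ts j).weight w) hj (Finset.mem_univ i)
      (Finset.mem_univ j) (weight_pos_s5 hw _) (fun k _ _ => Nat.zero_le _)
    omega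

end Term

namespace KBO

variable {σ : Type} {ar w : σ → ℕ} {prec : σ → σ → Prop}

/-- A case analysis on the predecessors of a term gives a criterion for accessibility. -/
theorem acc_mk {g : σ} {ts : Fin (ar g) → Term σ ar}
    (hweight : ∀ s : Term σ ar, s.weight w < (Term.mk g ts).weight w →
      Acc (fun s t : Term σ ar => KBO w prec t s) s)
    (hprec : ∀ (h : σ) (ss : Fin (ar h) → Term σ ar),
      (Term.mk g ts).weight w = (Term.mk h ss).weight w → prec g h →
      Acc (fun s t : Term σ ar => KBO w prec t s) (Term.mk h ss))
    (hlex : ∀ (ss : Fin (ar g) → Term σ ar) (i : Fin (ar g)),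
      (Term.mk g ts).weight w = (Term.mk g ss).weight w →
      (∀ j < i, ts j = ss j) → KBO w prec (ts i) (ss i) →
      Acc (fun s t : Term σ ar => KBO w prec t s) (Term.mk g ss)) :
    Acc (fun s t : Term σ ar => KBO w prec t s) (Term.mk g ts) := by
  refine Acc.intro _ fun s hs => ?_
  cases hs with
  | of_weight h => exact hweight s h
  | of_prec he h => exact hprec _ _ he h
  | of_lex i he heq h => exact hlex _ i he heq h

variable [Finite σ]

theorem acc_mk_of_weight_arg_lt (hw : IsWeightFn ar w) (hprec : IsStrictTotalOrder σ prec)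
    (hcompat : CompatiblePrec ar w prec) {n : ℕ}
    (ih : ∀ s : Term σ ar, s.weight w < n → Acc (fun s t : Term σ ar => KBO w prec t s) s)
    (g : σ) (hg : ¬(ar g = 1 ∧ w g = 0)) (ts : Fin (ar g) → Term σ ar)
    (hn : (Term.mk g ts).weight w = n) :
    Acc (fun s t : Term σ ar => KBO w prec t s) (Term.mk g ts) := by
  have hwf : WellFounded (Function.swap prec) := Finite.wellFounded_of_trans_of_irrefl _
  induction g using hwf.induction with
  | _ g ihg =>
  let r : {t : Term σ ar // t.weight w < n} → {t : Term σ ar // t.weight w < n} → Prop :=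
    fun s t => KBO w prec t.1 s.1
  have hr : WellFounded r :=
    ⟨fun t => InvImage.accessible Subtype.val (ih t.1 t.2)⟩
  have hlex : WellFounded (Pi.Lex (· < ·) (fun {_ : Fin (ar g)} => r)) :=
    Pi.Lex.wellFounded _ fun _ => hr
  have key : ∀ us : Fin (ar g) → {t : Term σ ar // t.weight w < n},
      (Term.mk g fun i => (us i).1).weight w = n →
      Acc (fun s t : Term σ ar => KBO w prec t s) (Term.mk g fun i => (us i).1) := by
    intro us
    induction us using hlex.induction with
    | _ us ihus =>
    intro hus
    refine acc_mk (fun s hs => ih s (hus ▸ hs)) (fun h ss he hp => ?_)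
      (fun ss i he heq hk => ?_)
    · refine ihg h hp (fun hh => ?_) ss (he ▸ hus)
      have hne : g ≠ h := fun e => irrefl_of prec h (e ▸ hp)
      exact asymm_of prec hp (hcompat h hh.1 hh.2 g hne)
    · have hss : (Term.mk g ss).weight w = n := he ▸ hus
      exact ihus (fun j => ⟨ss j, hss ▸ Term.weight_arg_lt_s5 hw hg ss j⟩)
        ⟨i, fun j hj => Subtype.ext (heq j hj).symm, hk⟩ hss
  exact key (fun i => ⟨ts i, hn ▸ Term.weight_arg_lt_s5 hw hg ts i⟩) hn

theorem acc_mk_of_acc_arg (hw : IsWeightFn ar w) (hprec : IsStrictTotalOrder σ prec)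
    (hcompat : CompatiblePrec ar w prec) {n : ℕ}
    (ih : ∀ s : Term σ ar, s.weight w < n → Acc (fun s t : Term σ ar => KBO w prec t s) s)
    {g : σ} (hg : ar g = 1 ∧ w g = 0) (i : Fin (ar g)) (t : Term σ ar)
    (ht : Acc (fun s t : Term σ ar => KBO w prec t s) t) (ts : Fin (ar g) → Term σ ar)
    (hts : ts i = t) (hn : (Term.mk g ts).weight w = n) :
    Acc (fun s t : Term σ ar => KBO w prec t s) (Term.mk g ts) := by
  induction ht generalizing ts with
  | intro t _ iht =>
  refine acc_mk (fun s hs => ih s (hn ▸ hs)) (fun h ss he hp => ?_) (fun ss j he _ hk => ?_)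
  · refine acc_mk_of_weight_arg_lt hw hprec hcompat ih h (fun hh => ?_) ss (he ▸ hn)
    have e : h = g := hw.2 h g hh.1 hh.2 hg.1 hg.2
    exact irrefl_of prec g (e ▸ hp)
  · have hji : j = i := Fin.ext (by have := i.2; have := j.2; omega)
    subst hji
    exact iht (ss j) (hts ▸ hk) ss rfl (he ▸ hn)

end KBO

theorem kbo_wellFounded {σ : Type} [Fintype σ] (ar w : σ → ℕ) (prec : σ → σ → Prop)
    (hconst : ∃ c, ar c = 0) (hw : IsWeightFn ar w)
    (hprec : IsStrictTotalOrder σ prec) (hcompat : CompatiblePrec ar w prec) :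
    WellFounded (fun s t : Term σ ar => KBO w prec t s) := by
  suffices H : ∀ n (t : Term σ ar), t.weight w = n →
      Acc (fun s t : Term σ ar => KBO w prec t s) t from ⟨fun t => H _ t rfl⟩
  intro n
  induction n using Nat.strong_induction_on with
  | _ n ih =>
  intro t
  induction t with
  | mk g ts iht =>
  intro hn
  have ih' (s : Term σ ar) (hs : s.weight w < n) := ih _ hs s rfl
  by_cases hg : ar g = 1 ∧ w g = 0
  · let i : Fin (ar g) := ⟨0, by omega⟩
    have hle : (ts i).weight w ≤ n := by
      rw [← hn, Term.weight_mk]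
      exact le_add_left (Finset.single_le_sum (f := fun j => (ts j).weight w)
        (fun j _ => Nat.zero_le _) (Finset.mem_univ i))
    have hi := hle.lt_or_eq.elim (ih' (ts i)) (iht i)
    exact KBO.acc_mk_of_acc_arg hw hprec hcompat ih' hg i (ts i) hi ts rfl hn
  · exact KBO.acc_mk_of_weight_arg_lt hw hprec hcompat ih' g hg ts hn
end

section
/- The Knuth-Bendix order is monotone: for every weight function w on Σ, every precedence ≫ compatible with w, every function symbol g ∈ Σ of arity n ≥ 1, every index 1 ≤ i ≤ n, and all ground terms r₁,…,rₙ and s, if rᵢ ≻ s then g(r₁,…,r_{i−1},rᵢ,r_{i+1},…,rₙ) ≻ g(r₁,…,r_{i−1},s,r_{i+1},…,rₙ). -/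
theorem KBO.weight_le {σ : Type} {ar w : σ → ℕ} {prec : σ → σ → Prop} {t s : Term σ ar}
    (h : KBO w prec t s) : s.weight w ≤ t.weight w := by
  cases h with
  | of_weight h => exact h.le
  | of_prec h _ => exact h.ge
  | of_lex _ h _ _ => exact h.ge

theorem Term.weight_mk_update_add {σ : Type} {ar : σ → ℕ} (w : σ → ℕ) (g : σ) (i : Fin (ar g))
    (r : Fin (ar g) → Term σ ar) (s : Term σ ar) :
    (Term.mk g (Function.update r i s)).weight w + (r i).weight w =
      (Term.mk g r).weight w + s.weight w := by
  have hsum : ∑ j ∈ Finset.univ.erase i, (Function.update r i s j).weight w =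
      ∑ j ∈ Finset.univ.erase i, (r j).weight w :=
    Finset.sum_congr rfl fun j hj => by
      rw [Function.update_of_ne (Finset.ne_of_mem_erase hj)]
  simp only [Term.weight, ← Finset.add_sum_erase _ _ (Finset.mem_univ i), hsum,
    Function.update_self]
  omega

theorem kbo_monotone {σ : Type} [Fintype σ] (ar w : σ → ℕ) (prec : σ → σ → Prop)
    (hconst : ∃ c, ar c = 0) (hw : IsWeightFn ar w)
    (hprec : IsStrictTotalOrder σ prec) (hcompat : CompatiblePrec ar w prec)
    (g : σ) (hg : 1 ≤ ar g) (i : Fin (ar g))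
    (r : Fin (ar g) → Term σ ar) (s : Term σ ar)
    (h : KBO w prec (r i) s) :
    KBO w prec (Term.mk g r) (Term.mk g (Function.update r i s)) := by
  have hadd := Term.weight_mk_update_add w g i r s
  rcases h.weight_le.lt_or_eq with hlt | heq
  · exact .of_weight (by omega)
  · refine .of_lex i (by omega) (fun j hj => ?_) ?_
    · rw [Function.update_of_ne hj.ne]
    · rwa [Function.update_self]
end

section
/- For natural numbers x, n₁,…,n_S, there exists a ground term of Σ of weight x and contents (n₁,…,n_S) if and only if x = Σ_{1 ≤ i ≤ S} w(gᵢ)·nᵢ and 1 + Σ_{1 ≤ i ≤ S} (arityᵢ − 1)·nᵢ = 0. -/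
theorem Term.weight_eq_sum_count {σ : Type} [Fintype σ] [DecidableEq σ] {ar : σ → ℕ}
    (w : σ → ℕ) (t : Term σ ar) :
    Term.weight w t = ∑ g, w g * Term.count g t := by
  induction t with
  | mk h args ih =>
    simp only [Term.weight, Term.count, mul_add, Finset.sum_add_distrib, ih, Finset.mul_sum,
      mul_ite, mul_one, mul_zero, Finset.sum_ite_eq, Finset.mem_univ, if_true]
    rw [Finset.sum_comm]

theorem Term.one_add_sum_arity_sub_one_mul_count {σ : Type} [Fintype σ] [DecidableEq σ]
    {ar : σ → ℕ} (t : Term σ ar) :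
    (1 : ℤ) + ∑ g, ((ar g : ℤ) - 1) * (Term.count g t : ℤ) = 0 := by
  induction t with
  | mk h args ih =>
    have key : ∀ i, ∑ g, ((ar g : ℤ) - 1) * (Term.count g (args i) : ℤ) = -1 := fun i => by
      linarith [ih i]
    simp only [Term.count, Nat.cast_add, Nat.cast_ite, Nat.cast_one, Nat.cast_zero, Nat.cast_sum,
      mul_add, Finset.sum_add_distrib, Finset.mul_sum, mul_ite, mul_one, mul_zero,
      Finset.sum_ite_eq, Finset.mem_univ, if_true]
    rw [Finset.sum_comm]
    simp only [key, Finset.sum_const, Finset.card_univ, Fintype.card_fin, nsmul_eq_mul]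
    ring

/-- A tuple of `k` terms jointly having contents `ν` exists as soon as the arities balance;
the case `k = 0` has to be restricted to empty contents. -/
theorem Term.exists_forest_of_contents {σ : Type} [Fintype σ] [DecidableEq σ] {ar : σ → ℕ}
    (N : ℕ) : ∀ (k : ℕ) (ν : σ → ℕ), ∑ g, ν g = N → (k = 0 → ∀ g, ν g = 0) →
      (k : ℤ) + ∑ g, ((ar g : ℤ) - 1) * (ν g : ℤ) = 0 →
      ∃ F : Fin k → Term σ ar, ∀ g, ∑ i, Term.count g (F i) = ν g := by
  induction N with
  | zero =>
    intro k ν hN _ hk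
    have hν : ∀ g, ν g = 0 := by simpa using hN
    obtain rfl : k = 0 := by simpa [hν] using hk
    exact ⟨Fin.elim0, by simp [hν]⟩
  | succ N ih =>
    intro k ν hN hzero hk
    obtain ⟨h, hpos, hroot⟩ : ∃ h, 0 < ν h ∧ (ar h = 0 → ∀ g, ν g ≠ 0 → ar g = 0) := by
      by_cases hex : ∃ h, 0 < ν h ∧ ar h ≠ 0
      · obtain ⟨h, h₁, h₂⟩ := hex
        exact ⟨h, h₁, fun h₃ => absurd h₃ h₂⟩
      · push Not at hex
        obtain ⟨h, -, hne⟩ := Finset.exists_ne_zero_of_sum_ne_zero (hN.trans_ne N.succ_ne_zero)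
        exact ⟨h, Nat.pos_of_ne_zero hne, fun _ g hg => hex g (Nat.pos_of_ne_zero hg)⟩
    obtain ⟨m, rfl⟩ : ∃ m, k = m + 1 :=
      Nat.exists_eq_succ_of_ne_zero fun h₀ => hpos.ne' (hzero h₀ h)
    obtain ⟨ν', hν'⟩ : ∃ ν' : σ → ℕ, ∀ g, ν g = (if h = g then 1 else 0) + ν' g := by
      refine ⟨fun g => ν g - if h = g then 1 else 0, fun g => ?_⟩
      by_cases hg : h = g
      · subst hg; simp; omega
      · simp [hg]
    have hN' : ∑ g, ν' g = N := by
      simp only [hν', Finset.sum_add_distrib, Finset.sum_ite_eq, Finset.mem_univ, if_true] at hN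
      omega
    have hk' : ((ar h + m : ℕ) : ℤ) + ∑ g, ((ar g : ℤ) - 1) * (ν' g : ℤ) = 0 := by
      simp only [hν', Nat.cast_add, Nat.cast_ite, Nat.cast_one, Nat.cast_zero, mul_add,
        Finset.sum_add_distrib, mul_ite, mul_one, mul_zero, Finset.sum_ite_eq, Finset.mem_univ,
        if_true] at hk
      push_cast
      linarith
    have hzero' : ar h + m = 0 → ∀ g, ν' g = 0 := by
      intro h₀
      have hsum : ∑ g, ((ar g : ℤ) - 1) * (ν' g : ℤ) = -∑ g, (ν' g : ℤ) := by
        rw [← Finset.sum_neg_distrib]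
        refine Finset.sum_congr rfl fun g _ => ?_
        by_cases hg : ν' g = 0
        · simp [hg]
        · simp [hroot (by omega) g (by rw [hν']; omega)]
      rw [hsum, h₀] at hk'
      have hsum₀ : ∑ g, ν' g = 0 := by
        zify
        simpa using hk'
      simpa using hsum₀
    obtain ⟨F, hF⟩ := ih (ar h + m) ν' hN' hzero' hk'
    refine ⟨Fin.cons (Term.mk h fun i => F (Fin.castAdd m i)) fun j => F (Fin.natAdd (ar h) j),
      fun g => ?_⟩
    rw [Fin.sum_univ_succ, hν', ← hF, Fin.sum_univ_add]
    simp only [Fin.cons_zero, Fin.cons_succ, Term.count]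
    ring

theorem exists_term_of_weight_and_contents_iff {σ : Type} [Fintype σ] [DecidableEq σ]
    (ar w : σ → ℕ) (hconst : ∃ c, ar c = 0) (hw : IsWeightFn ar w)
    (x : ℕ) (ν : σ → ℕ) :
    (∃ t : Term σ ar, Term.weight w t = x ∧ ∀ g, Term.count g t = ν g) ↔
      (x = ∑ g : σ, w g * ν g ∧
        (1 : ℤ) + ∑ g : σ, ((ar g : ℤ) - 1) * (ν g : ℤ) = 0) := by
  constructor
  · rintro ⟨t, rfl, hν⟩
    simp only [← hν]
    exact ⟨t.weight_eq_sum_count w, t.one_add_sum_arity_sub_one_mul_count⟩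
  · rintro ⟨rfl, hk⟩
    obtain ⟨F, hF⟩ := Term.exists_forest_of_contents _ 1 ν rfl (by simp) (by simpa using hk)
    have hcount : ∀ g, Term.count g (F 0) = ν g := by simpa using hF
    exact ⟨F 0, by simp only [Term.weight_eq_sum_count, hcount], hcount⟩
end

section
/- Let N, x, n₁,…,n_S be natural numbers such that there exists a ground term of weight x and contents (n₁,…,n_S), the total count Σ{nᵢ : arityᵢ ≥ 2} is at least 1, and the total count Σ{nᵢ : arityᵢ ≥ 1} is at least N. Then there exist at least N pairwise distinct ground terms with contents (n₁,…,n_S). -/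
/-- The multiset of all symbol occurrences in a term. -/
def Term.contents {σ : Type} {ar : σ → ℕ} : Term σ ar → Multiset σ
  | .mk g args => {g} + ∑ i, Term.contents (args i)

theorem Term.count_contents {σ : Type} {ar : σ → ℕ} [DecidableEq σ] (g : σ) (t : Term σ ar) :
    t.contents.count g = Term.count g t := by
  induction t with
  | mk h args ih =>
    simp only [Term.contents, Term.count, Multiset.count_add, Multiset.count_sum', ih,
      Multiset.count_singleton, eq_comm]

theorem Term.card_contents {σ : Type} {ar : σ → ℕ} (t : Term σ ar) :
    t.contents.card = 1 + (t.contents.map ar).sum := by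
  induction t with
  | mk h args ih =>
    have hsum : ((∑ i, (args i).contents).map ar).sum =
        ∑ i, ((args i).contents.map ar).sum :=
      map_sum (Multiset.sumAddMonoidHom.comp (Multiset.mapAddMonoidHom ar)) _ _
    simp only [Term.contents, Multiset.card_add, Multiset.card_singleton, Multiset.card_sum, ih,
      Multiset.map_add, Multiset.sum_add, hsum, Finset.sum_add_distrib]
    simp

/-- The term with head symbol `g` and the given list of arguments. -/
def Term.ofList {σ : Type} {ar : σ → ℕ} (g : σ) (l : List (Term σ ar)) (h : l.length = ar g) :
    Term σ ar :=
  .mk g fun i => l[i.val]'(i.isLt.trans_eq h.symm)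

theorem Term.contents_ofList {σ : Type} {ar : σ → ℕ} (g : σ) (l : List (Term σ ar))
    (h : l.length = ar g) :
    (Term.ofList g l h).contents = {g} + (l.map Term.contents).sum := by
  rw [Term.ofList, Term.contents, ← Fin.sum_univ_fun_getElem]
  congr 1
  exact (Equiv.sum_comp (finCongr h) _).symm

/-- The number of non-constant symbol occurrences in the first argument of a term. -/
def Term.headSize {σ : Type} {ar : σ → ℕ} : Term σ ar → ℕ
  | .mk g args =>
    if h : 0 < ar g then ((args ⟨0, h⟩).contents.filter (fun g => 1 ≤ ar g)).card else 0

theorem Term.headSize_ofList_cons {σ : Type} {ar : σ → ℕ} (g : σ) (s : Term σ ar)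
    (l : List (Term σ ar)) (h : (s :: l).length = ar g) :
    (Term.ofList g (s :: l) h).headSize = (s.contents.filter (fun g => 1 ≤ ar g)).card := by
  have hpos : 0 < ar g := by rw [← h]; simp
  simp [Term.ofList, Term.headSize, hpos]

theorem Term.exists_constants {σ : Type} {ar : σ → ℕ} (C : List σ) (hC : ∀ c ∈ C, ar c = 0) :
    ∃ l : List (Term σ ar), l.length = C.length ∧ (l.map Term.contents).sum = (C : Multiset σ) := by
  induction C with
  | nil => exact ⟨[], by simp⟩
  | cons c C ih =>
    obtain ⟨l, hl, hs⟩ := ih fun d hd => hC d (List.mem_cons_of_mem _ hd)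
    refine ⟨Term.ofList c [] (by simp [hC c]) :: l, by simp [hl], ?_⟩
    simp [Term.contents_ofList, hs]

/-- Non-constant symbols `L` can be nested along first arguments, with the constants `C` filling
the remaining argument places. -/
theorem Term.exists_chain {σ : Type} {ar : σ → ℕ} (L : List σ) (hL : ∀ g ∈ L, 1 ≤ ar g)
    (C : List σ) (hC : ∀ c ∈ C, ar c = 0)
    (hcard : C.length = 1 + (L.map fun g => ar g - 1).sum) :
    ∃ t : Term σ ar, t.contents = (L : Multiset σ) + C := by
  induction L generalizing C with
  | nil =>
    obtain ⟨c, rfl⟩ := List.length_eq_one_iff.mp (by simpa using hcard)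
    exact ⟨Term.ofList c [] (by simp [hC c]), by simp [Term.contents_ofList]⟩
  | cons g L ih =>
    simp only [List.map_cons, List.sum_cons] at hcard
    have hg := hL g List.mem_cons_self
    obtain ⟨l, hl, hs⟩ := Term.exists_constants (C.take (ar g - 1))
      fun c hc => hC c (List.mem_of_mem_take hc)
    obtain ⟨t, ht⟩ := ih (fun d hd => hL d (List.mem_cons_of_mem _ hd)) (C.drop (ar g - 1))
      (fun c hc => hC c (List.mem_of_mem_drop hc)) (by rw [List.length_drop]; omega)
    refine ⟨Term.ofList g (t :: l) ?_, ?_⟩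
    · rw [List.length_cons, hl, List.length_take]; omega
    · have hC' : (C : Multiset σ) = (C.take (ar g - 1) : List σ) + (C.drop (ar g - 1) : List σ) := by
        rw [Multiset.coe_add, List.take_append_drop]
      rw [Term.contents_ofList, List.map_cons, List.sum_cons, ht, hs, hC', ← Multiset.cons_coe,
        ← Multiset.singleton_add]
      abel

/-- A symbol `b` of arity at least two can be placed above two chains, the first of which contains
exactly the first `k` of the other non-constant symbols. -/
theorem Term.exists_headSize_eq {σ : Type} {ar : σ → ℕ} (b : σ) (hb : 2 ≤ ar b)
    (L : List σ) (hL : ∀ g ∈ L, 1 ≤ ar g) (C : List σ) (hC : ∀ c ∈ C, ar c = 0)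
    (hcard : C.length = ar b + (L.map fun g => ar g - 1).sum) (k : ℕ) (hk : k ≤ L.length) :
    ∃ t : Term σ ar, t.contents = {b} + ((L : Multiset σ) + C) ∧ t.headSize = k := by
  have hsplit : (L.map fun g => ar g - 1).sum =
      ((L.take k).map fun g => ar g - 1).sum + ((L.drop k).map fun g => ar g - 1).sum := by
    rw [← List.sum_append, ← List.map_append, List.take_append_drop]
  set p := 1 + ((L.take k).map fun g => ar g - 1).sum with hp
  set q := 1 + ((L.drop k).map fun g => ar g - 1).sum with hq
  obtain ⟨s, hs⟩ := Term.exists_chain (L.take k) (fun g hg => hL g (List.mem_of_mem_take hg))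
    (C.take p) (fun c hc => hC c (List.mem_of_mem_take hc)) (by rw [List.length_take]; omega)
  obtain ⟨t, ht⟩ := Term.exists_chain (L.drop k) (fun g hg => hL g (List.mem_of_mem_drop hg))
    ((C.drop p).take q) (fun c hc => hC c (List.mem_of_mem_drop (List.mem_of_mem_take hc)))
    (by rw [List.length_take, List.length_drop]; omega)
  obtain ⟨l, hl, hls⟩ := Term.exists_constants ((C.drop p).drop q)
    fun c hc => hC c (List.mem_of_mem_drop (List.mem_of_mem_drop hc))
  refine ⟨Term.ofList b (s :: t :: l) ?_, ?_, ?_⟩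
  · simp only [List.length_cons, hl, List.length_drop]; omega
  · have hL' : (L : Multiset σ) = (L.take k : List σ) + (L.drop k : List σ) := by
      rw [Multiset.coe_add, List.take_append_drop]
    have hC' : (C : Multiset σ) = (C.take p : List σ) +
        (((C.drop p).take q : List σ) + ((C.drop p).drop q : List σ)) := by
      rw [Multiset.coe_add, Multiset.coe_add, List.take_append_drop, List.take_append_drop]
    rw [Term.contents_ofList, List.map_cons, List.map_cons, List.sum_cons, List.sum_cons, hs, ht,
      hls, hL', hC']
    abel
  · rw [Term.headSize_ofList_cons, hs, Multiset.filter_add, Multiset.card_add,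
      Multiset.filter_eq_self.mpr fun g hg => hL g (List.mem_of_mem_take hg),
      Multiset.filter_eq_nil.mpr fun c hc => by
        have := hC c (List.mem_of_mem_take hc)
        omega]
    simp [hk]

theorem Multiset.card_filter_eq_sum_count {α : Type*} [Fintype α] [DecidableEq α]
    (s : Multiset α) (p : α → Prop) [DecidablePred p] :
    (s.filter p).card = ∑ a ∈ Finset.univ.filter p, s.count a := by
  rw [← Multiset.sum_count_eq_card (s := Finset.univ) fun a _ => Finset.mem_univ a,
    Finset.sum_filter]
  exact Finset.sum_congr rfl fun a _ => Multiset.count_filter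

theorem many_terms_of_contents_binary {σ : Type} [Fintype σ] [DecidableEq σ]
    (ar w : σ → ℕ) (hconst : ∃ c, ar c = 0) (hw : IsWeightFn ar w)
    (N x : ℕ) (ν : σ → ℕ)
    (hex : ∃ t : Term σ ar, Term.weight w t = x ∧ ∀ g, Term.count g t = ν g)
    (hbin : 1 ≤ ∑ g ∈ Finset.univ.filter (fun g => 2 ≤ ar g), ν g)
    (hfun : N ≤ ∑ g ∈ Finset.univ.filter (fun g => 1 ≤ ar g), ν g) :
    ∃ F : Fin N → Term σ ar, Function.Injective F ∧
      ∀ i g, Term.count g (F i) = ν g := by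
  obtain ⟨t, -, ht⟩ := hex
  have hcount : ∀ g, t.contents.count g = ν g := fun g => by rw [Term.count_contents, ht]
  obtain ⟨b, hb, hνb⟩ := Finset.exists_ne_zero_of_sum_ne_zero (Nat.one_le_iff_ne_zero.mp hbin)
  replace hb : 2 ≤ ar b := (Finset.mem_filter.mp hb).2
  have hbt : b ∈ t.contents.filter fun g => 1 ≤ ar g :=
    Multiset.mem_filter.mpr
      ⟨Multiset.count_ne_zero.mp (by rwa [hcount]), by omega⟩
  have hM : N ≤ (t.contents.filter fun g => 1 ≤ ar g).card := by
    simpa only [Multiset.card_filter_eq_sum_count, hcount] using hfun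
  have hmem : ∀ g ∈ t.contents.filter fun g => 1 ≤ ar g, 1 ≤ ar g :=
    fun g hg => (Multiset.mem_filter.mp hg).2
  have hC : ∀ c ∈ t.contents.filter fun g => ¬ 1 ≤ ar g, ar c = 0 := fun c hc => by
    have := (Multiset.mem_filter.mp hc).2
    omega
  have hdecomp := Multiset.filter_add_not (fun g => 1 ≤ ar g) t.contents
  obtain ⟨L, hL⟩ := Multiset.exists_cons_of_mem hbt
  induction L using Quotient.inductionOn with | _ L
  obtain ⟨C, hCeq⟩ := Quotient.exists_rep (t.contents.filter fun g => ¬ 1 ≤ ar g)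
  change (C : Multiset σ) = _ at hCeq
  change _ = b ::ₘ (L : Multiset σ) at hL
  rw [← hCeq] at hC hdecomp
  rw [hL] at hmem hM hdecomp
  replace hmem : ∀ g ∈ L, 1 ≤ ar g := fun g hg => hmem g (by simp [hg])
  replace hC : ∀ c ∈ C, ar c = 0 := fun c hc => hC c (by simpa using hc)
  have hcard : C.length = ar b + (L.map fun g => ar g - 1).sum := by
    have h := t.card_contents
    have hC0 : (C.map ar).sum = 0 := by simpa [List.sum_eq_zero_iff] using hC
    have hL1 : (L.map ar).sum = (L.map fun g => ar g - 1).sum + L.length := by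
      rw [← Nat.mul_one L.length, ← smul_eq_mul, ← List.sum_replicate, ← List.map_const',
        ← List.sum_map_add]
      congr 1
      exact List.map_congr_left fun g hg => (Nat.sub_add_cancel (hmem g hg)).symm
    rw [← hdecomp] at h
    simp [hC0, hL1] at h
    omega
  have key : ∀ i : Fin N, ∃ s : Term σ ar, s.contents = t.contents ∧ s.headSize = i := fun i => by
    have hi := i.isLt
    rw [Multiset.card_cons, Multiset.coe_card] at hM
    obtain ⟨s, hs, hsi⟩ := Term.exists_headSize_eq b hb L hmem C hC hcard i (by omega)
    exact ⟨s, by rw [hs, ← hdecomp, ← Multiset.singleton_add, add_assoc], hsi⟩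
  choose F hF hFi using key
  refine ⟨F, fun i j hij => Fin.ext ?_, fun i g => ?_⟩
  · rw [← hFi i, hij, hFi j]
  · rw [← Term.count_contents, hF, hcount]
end

section
/- Let N, x, n₁,…,n_S be natural numbers such that there exists a ground term of weight x and contents (n₁,…,n_S), the total count Σ{nᵢ : arityᵢ ≥ 1} is at least N, and there are at least two distinct unary function symbols gᵢ, gⱼ with nᵢ > 0 and nⱼ > 0. Then there exist at least N pairwise distinct ground terms with contents (n₁,…,n_S). -/
namespace Term

variable {σ : Type} {ar : σ → ℕ}

/-- Apply the function symbol `u` to copies of `s`; used for unary `u`. -/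
def applyConst (u : σ) (s : Term σ ar) : Term σ ar := .mk u fun _ => s

theorem applyConst_injective {u : σ} (hu : ar u = 1) :
    Function.Injective (applyConst (ar := ar) u) := by
  intro s t h
  simp only [applyConst, Term.mk.injEq, heq_eq_eq, true_and] at h
  exact congrFun h ⟨0, by omega⟩

theorem applyConst_ne {u v : σ} (huv : u ≠ v) (s t : Term σ ar) :
    applyConst u s ≠ applyConst v t := by
  intro h
  simp only [applyConst, Term.mk.injEq] at h
  exact huv h.1

variable [DecidableEq σ]

theorem count_applyConst {u : σ} (hu : ar u = 1) (g : σ) (s : Term σ ar) :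
    count g (applyConst u s) = (if u = g then 1 else 0) + count g s := by
  simp [applyConst, count, hu]

theorem count_mk_update (g h : σ) (args : Fin (ar h) → Term σ ar) (i : Fin (ar h))
    (s : Term σ ar) {k : ℕ} (hs : count g s = k + count g (args i)) :
    count g (mk h (Function.update args i s)) = k + count g (mk h args) := by
  have h1 := Finset.add_sum_erase Finset.univ
    (fun j => count g (Function.update args i s j)) (Finset.mem_univ i)
  have h2 := Finset.add_sum_erase Finset.univ
    (fun j => count g (args j)) (Finset.mem_univ i)
  have h3 : ∑ j ∈ Finset.univ.erase i, count g (Function.update args i s j)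
      = ∑ j ∈ Finset.univ.erase i, count g (args j) :=
    Finset.sum_congr rfl fun j hj => by
      rw [Function.update_of_ne (Finset.ne_of_mem_erase hj)]
  simp only [Function.update_self] at h1
  simp only [count]
  omega

/-- An occurrence of a unary symbol can be moved to the root. -/
theorem exists_applyConst_of_count_pos {u : σ} (hu : ar u = 1) (t : Term σ ar)
    (ht : 0 < count u t) : ∃ s : Term σ ar, ∀ g, count g t = count g (applyConst u s) := by
  induction t with
  | mk h args ih =>
    by_cases hh : h = u
    · subst hh
      refine ⟨args ⟨0, by omega⟩, fun g => ?_⟩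
      have : args = fun _ => args ⟨0, by omega⟩ := by
        funext j
        congr 1
        apply Fin.ext
        simp only
        omega
      rw [applyConst, ← this]
    · simp only [count, if_neg hh, zero_add] at ht
      obtain ⟨i, -, hi⟩ := Finset.exists_ne_zero_of_sum_ne_zero ht.ne'
      obtain ⟨s, hs⟩ := ih i (Nat.pos_of_ne_zero hi)
      refine ⟨mk h (Function.update args i s), fun g => ?_⟩
      rw [count_applyConst hu]
      have key := count_mk_update g h (Function.update args i s) i (args i)
        (k := if u = g then 1 else 0) (by
          rw [Function.update_self, hs g, count_applyConst hu])
      simpa using key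

variable [Fintype σ]

/-- The number of occurrences of non-constant symbols. -/
def funCount (t : Term σ ar) : ℕ :=
  ∑ g ∈ Finset.univ.filter (fun g => 1 ≤ ar g), count g t

theorem funCount_congr {s t : Term σ ar} (h : ∀ g, count g s = count g t) :
    funCount s = funCount t :=
  Finset.sum_congr rfl fun g _ => h g

theorem funCount_mk (h : σ) (args : Fin (ar h) → Term σ ar) :
    funCount (mk h args) = (if 1 ≤ ar h then 1 else 0) + ∑ i, funCount (args i) := by
  simp only [funCount, count, Finset.sum_add_distrib]
  rw [Finset.sum_comm]
  simp

theorem funCount_applyConst {u : σ} (hu : ar u = 1) (s : Term σ ar) :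
    funCount (applyConst u s) = 1 + funCount s := by
  simp [applyConst, funCount_mk, hu]

/-- A unary symbol not occurring in `s` can be inserted above any node of `s`. -/
theorem exists_finset_insert {u : σ} (hu : ar u = 1) (s : Term σ ar) (hs : count u s = 0) :
    ∃ F : Finset (Term σ ar), 1 + funCount s ≤ F.card ∧
      ∀ t ∈ F, ∀ g, count g t = (if u = g then 1 else 0) + count g s := by
  classical
  induction s with
  | mk h args ih =>
    have hs' := hs
    simp only [count, Nat.add_eq_zero_iff, Finset.sum_eq_zero_iff, Finset.mem_univ,
      true_imp_iff] at hs'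
    obtain ⟨hhu, hargs⟩ := hs'
    have hhu : h ≠ u := by
      rintro rfl
      simp at hhu
    choose F hF hc using fun i => ih i (hargs i)
    have hself : ∀ i, ∀ t ∈ F i, t ≠ args i := by
      rintro i t ht rfl
      have := hc i _ ht u
      simp [hargs i] at this
    let G : Finset (Term σ ar) := Finset.univ.biUnion fun i =>
      (F i).image fun t => mk h (Function.update args i t)
    have hinj : ∀ i, Function.Injective fun t => mk h (Function.update args i t) := by
      intro i s t hst
      simp only [Term.mk.injEq, heq_eq_eq, true_and] at hst
      simpa using congrFun hst i
    have hG : G.card = ∑ i, (F i).card := by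
      rw [Finset.card_biUnion]
      · exact Finset.sum_congr rfl fun i _ => Finset.card_image_of_injective _ (hinj i)
      · intro i _ j _ hij
        rw [Function.onFun, Finset.disjoint_left]
        intro t ht ht'
        obtain ⟨a, ha, rfl⟩ := Finset.mem_image.mp ht
        obtain ⟨b, hb, hab⟩ := Finset.mem_image.mp ht'
        simp only [Term.mk.injEq, heq_eq_eq, true_and] at hab
        have := congrFun hab i
        rw [Function.update_self, Function.update_of_ne hij] at this
        exact hself i a ha this.symm
    have hroot : applyConst u (mk h args) ∉ G := by
      simp only [G, Finset.mem_biUnion, Finset.mem_image, not_exists, not_and]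
      intro i _ a _ hEq
      simp only [applyConst, Term.mk.injEq] at hEq
      exact hhu hEq.1
    refine ⟨insert (applyConst u (mk h args)) G, ?_, ?_⟩
    · rw [Finset.card_insert_of_notMem hroot, hG, funCount_mk]
      have h1 : ∑ i, (1 + funCount (args i)) ≤ ∑ i, (F i).card :=
        Finset.sum_le_sum fun i _ => hF i
      simp only [Finset.sum_add_distrib, Finset.sum_const, Finset.card_univ, Fintype.card_fin,
        smul_eq_mul, mul_one] at h1
      split_ifs <;> omega
    · intro t ht g
      rcases Finset.mem_insert.mp ht with rfl | ht
      · exact count_applyConst hu g _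
      · simp only [G, Finset.mem_biUnion, Finset.mem_image] at ht
        obtain ⟨i, -, a, ha, rfl⟩ := ht
        exact count_mk_update g h args i a (hc i a ha g)

/-- There are at least `funCount t` terms with the contents of `t`. -/
def HasManyTerms (t : Term σ ar) : Prop :=
  ∃ F : Finset (Term σ ar), funCount t ≤ F.card ∧ ∀ s ∈ F, ∀ g, count g s = count g t

theorem HasManyTerms.of_applyConst {u v : σ} (huv : u ≠ v) (hu : ar u = 1)
    {t s r : Term σ ar} (hs : ∀ g, count g t = count g (applyConst u s))
    (hr : ∀ g, count g t = count g (applyConst v r)) (h : HasManyTerms s) :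
    HasManyTerms t := by
  classical
  obtain ⟨F, hF, hc⟩ := h
  have hr' : applyConst v r ∉ F.image (applyConst u) := by
    simp only [Finset.mem_image, not_exists, not_and]
    exact fun a _ => applyConst_ne huv a r
  refine ⟨insert (applyConst v r) (F.image (applyConst u)), ?_, ?_⟩
  · rw [Finset.card_insert_of_notMem hr',
      Finset.card_image_of_injective _ (applyConst_injective hu), funCount_congr hs,
      funCount_applyConst hu]
    omega
  · intro a ha g
    rcases Finset.mem_insert.mp ha with rfl | ha
    · exact (hr g).symm
    · obtain ⟨b, hb, rfl⟩ := Finset.mem_image.mp ha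
      rw [hs, count_applyConst hu, count_applyConst hu, hc b hb]

theorem HasManyTerms.of_count_eq_zero {u v : σ} (huv : u ≠ v) (hu : ar u = 1) (hv : ar v = 1)
    {t s : Term σ ar} (hs : ∀ g, count g t = count g (applyConst u (applyConst v s)))
    (h : count u s = 0) : HasManyTerms t := by
  classical
  obtain ⟨F, hF, hc⟩ := exists_finset_insert hu s h
  have hnot : applyConst u (applyConst v s) ∉ F.image (applyConst v) := by
    simp only [Finset.mem_image, not_exists, not_and]
    exact fun a _ => applyConst_ne huv.symm a _
  refine ⟨insert (applyConst u (applyConst v s)) (F.image (applyConst v)), ?_, ?_⟩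
  · rw [Finset.card_insert_of_notMem hnot,
      Finset.card_image_of_injective _ (applyConst_injective hv), funCount_congr hs,
      funCount_applyConst hu, funCount_applyConst hv]
    omega
  · intro a ha g
    rcases Finset.mem_insert.mp ha with rfl | ha
    · exact (hs g).symm
    · obtain ⟨b, hb, rfl⟩ := Finset.mem_image.mp ha
      rw [hs, count_applyConst hu, count_applyConst hv, count_applyConst hv, hc b hb]
      omega

theorem hasManyTerms {u v : σ} (huv : u ≠ v) (hu : ar u = 1) (hv : ar v = 1)
    (t : Term σ ar) (htu : 0 < count u t) (htv : 0 < count v t) : HasManyTerms t := by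
  induction hn : count u t + count v t using Nat.strong_induction_on generalizing t with
  | _ n ih =>
    obtain ⟨p, hp⟩ := exists_applyConst_of_count_pos hu t htu
    obtain ⟨q, hq⟩ := exists_applyConst_of_count_pos hv t htv
    have hpu : count u t = 1 + count u p := by simpa [count_applyConst hu] using hp u
    have hpv : count v t = count v p := by simpa [count_applyConst hu, huv] using hp v
    have hqu : count u t = count u q := by simpa [count_applyConst hv, huv.symm] using hq u
    have hqv : count v t = 1 + count v q := by simpa [count_applyConst hv] using hq v
    rcases Nat.eq_zero_or_pos (count u p) with h0 | hpos
    · rcases Nat.eq_zero_or_pos (count v q) with h0' | hpos'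
      · obtain ⟨s, hs⟩ := exists_applyConst_of_count_pos hv p (by omega)
        refine .of_count_eq_zero huv hu hv (s := s) (fun g => ?_) ?_
        · rw [hp, count_applyConst hu, count_applyConst hu, hs]
        · simpa [count_applyConst hv, huv.symm, h0] using (hs u).symm
      · exact .of_applyConst huv.symm hv hq hp (ih _ (by omega) q (by omega) hpos' rfl)
    · exact .of_applyConst huv hu hp hq (ih _ (by omega) p hpos (by omega) rfl)

end Term

theorem many_terms_of_contents_two_unaries {σ : Type} [Fintype σ] [DecidableEq σ]
    (ar w : σ → ℕ) (hconst : ∃ c, ar c = 0) (hw : IsWeightFn ar w)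
    (N x : ℕ) (ν : σ → ℕ)
    (hex : ∃ t : Term σ ar, Term.weight w t = x ∧ ∀ g, Term.count g t = ν g)
    (hfun : N ≤ ∑ g ∈ Finset.univ.filter (fun g => 1 ≤ ar g), ν g)
    (u v : σ) (huv : u ≠ v) (hu : ar u = 1) (hv : ar v = 1)
    (hnu : 0 < ν u) (hnv : 0 < ν v) :
    ∃ F : Fin N → Term σ ar, Function.Injective F ∧
      ∀ i g, Term.count g (F i) = ν g := by
  obtain ⟨t, -, ht⟩ := hex
  obtain ⟨F, hF, hc⟩ := Term.hasManyTerms huv hu hv t (by rwa [ht]) (by rwa [ht])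
  have hN : N ≤ F.card := by
    simp only [Term.funCount, ht] at hF
    exact hfun.trans hF
  refine ⟨fun i => F.equivFin.symm (Fin.castLE hN i), ?_, fun i g => ?_⟩
  · exact Subtype.val_injective.comp
      (F.equivFin.symm.injective.comp (Fin.castLE_injective hN))
  · rw [hc _ (F.equivFin.symm (Fin.castLE hN i)).2, ht]
end

section
/- Suppose the signature Σ contains a function symbol of arity at least 2, or contains at least two distinct unary function symbols. Then there exist natural numbers N₁ and N₂ such that for all natural numbers N and x with x > N·N₁ + N₂, the number of ground terms of weight x is either 0 or strictly greater than N. -/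
namespace Term

variable {σ : Type} {ar : σ → ℕ}

/-- A symbol applied to copies of a single term. -/
def diag (u : σ) (t : Term σ ar) : Term σ ar :=
  .mk u fun _ => t

/-- A symbol applied to `t` at position `k` and to `s` at all other positions. -/
def plug (b : σ) (k : Fin (ar b)) (s t : Term σ ar) : Term σ ar :=
  .mk b (Function.update (fun _ => s) k t)

theorem diag_injective {u : σ} (hu : ar u = 1) :
    Function.Injective (diag u : Term σ ar → Term σ ar) := by
  intro s t h
  simp only [diag, mk.injEq, heq_eq_eq, true_and] at h
  exact congrFun h ⟨0, by omega⟩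

theorem weight_diag (w : σ → ℕ) {u : σ} (hu : ar u = 1) (t : Term σ ar) :
    weight w (diag u t) = weight w t + w u := by
  simp [diag, weight, hu, add_comm]

theorem plug_injective (b : σ) (k : Fin (ar b)) (s : Term σ ar) :
    Function.Injective (plug b k s) := by
  intro t t' h
  simp only [plug, mk.injEq, heq_eq_eq, true_and] at h
  simpa using congrFun h k

theorem weight_plug (w : σ → ℕ) (b : σ) (k : Fin (ar b)) (s t : Term σ ar) :
    weight w (plug b k s t) = weight w t + (w b + (ar b - 1) * weight w s) := by
  have h : ∑ i ∈ Finset.univ.erase k,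
      weight w (Function.update (fun _ => s) k t i) = (ar b - 1) * weight w s := by
    rw [Finset.sum_congr rfl fun i hi => by
      rw [Function.update_of_ne (Finset.ne_of_mem_erase hi)]]
    simp [Finset.card_erase_of_mem]
  rw [plug, weight, ← Finset.add_sum_erase _ _ (Finset.mem_univ k), h, Function.update_self]
  ring

theorem weight_iterate (w : σ → ℕ) {A : Term σ ar → Term σ ar} {p : ℕ}
    (hA : ∀ t, weight w (A t) = weight w t + p) (n : ℕ) (t : Term σ ar) :
    weight w (A^[n] t) = weight w t + n * p := by
  induction n with
  | zero => simp
  | succ n ih => rw [Function.iterate_succ_apply', hA, ih]; ring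

end Term

/-- The words `A ^ i * B ^ (k - i)` with `i ≤ N < k` act differently on any point, provided `A`
is injective and no value of `A` is a value of `B ∘ B`. -/
theorem iterate_iterate_injective {α : Type*} {A B : α → α} (hA : Function.Injective A)
    (hAB : ∀ y z, A y ≠ B (B z)) {N k : ℕ} (hk : N < k) (t : α) :
    Function.Injective fun i : Fin (N + 1) => A^[i] (B^[k - i] t) := by
  refine Function.Injective.of_lt_imp_ne fun i j hij h => ?_
  have hij : (i : ℕ) < j := hij
  have hj := j.isLt
  obtain ⟨d, hd⟩ : ∃ d, (j : ℕ) = i + (d + 1) := ⟨j - i - 1, by omega⟩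
  obtain ⟨e, he⟩ : ∃ e, k - (i : ℕ) = e + 1 + 1 := ⟨k - i - 2, by omega⟩
  simp only [he, hd] at h
  rw [Function.iterate_add_apply A] at h
  have h := hA.iterate i h
  rw [Function.iterate_succ_apply', Function.iterate_succ_apply',
    Function.iterate_succ_apply'] at h
  exact hAB _ _ h.symm

/-- Two sufficiently different term transformations that add the same positive weight produce many
terms of every large weight that occurs modulo that amount. -/
theorem zero_or_many_of_transformations {σ : Type} {ar : σ → ℕ} (w : σ → ℕ)
    {A B : Term σ ar → Term σ ar} {p : ℕ} (hp : 0 < p)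
    (hwA : ∀ t, Term.weight w (A t) = Term.weight w t + p)
    (hwB : ∀ t, Term.weight w (B t) = Term.weight w t + p)
    (hA : Function.Injective A) (hAB : ∀ y z, A y ≠ B (B z)) :
    ∃ N₁ N₂ : ℕ, ∀ N x : ℕ, N * N₁ + N₂ < x →
      (∀ t : Term σ ar, Term.weight w t ≠ x) ∨
      ∃ F : Fin (N + 1) → Term σ ar, Function.Injective F ∧
        ∀ i, Term.weight w (F i) = x := by
  have hm : ∀ r, ∃ m, (∃ t : Term σ ar, Term.weight w t % p = r) →
      ∃ t : Term σ ar, Term.weight w t % p = r ∧ Term.weight w t = m := by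
    intro r
    by_cases h : ∃ t : Term σ ar, Term.weight w t % p = r
    · obtain ⟨t, ht⟩ := h
      exact ⟨_, fun _ => ⟨t, ht, rfl⟩⟩
    · exact ⟨0, fun h' => absurd h' h⟩
  choose m hm using hm
  refine ⟨p, p + ∑ r ∈ Finset.range p, m r, fun N x hx => ?_⟩
  by_cases hS : ∃ t : Term σ ar, Term.weight w t = x
  swap
  · exact .inl fun t ht => hS ⟨t, ht⟩
  right
  obtain ⟨s, hs⟩ := hS
  obtain ⟨t, ht, htm⟩ := hm (x % p) ⟨s, by rw [hs]⟩
  have hle : m (x % p) ≤ ∑ r ∈ Finset.range p, m r :=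
    Finset.single_le_sum (fun _ _ => Nat.zero_le _) (Finset.mem_range.2 (Nat.mod_lt _ hp))
  have htx : Term.weight w t ≤ x := by omega
  obtain ⟨k, hk⟩ := (Nat.modEq_iff_dvd' htx).1 ht
  have hNk : N < k := by
    refine Nat.lt_of_mul_lt_mul_left (a := p) ?_
    rw [← hk, mul_comm]
    omega
  refine ⟨_, iterate_iterate_injective hA hAB hNk t, fun i => ?_⟩
  have hi : (i : ℕ) + (k - i) = k := by omega
  calc _ = Term.weight w t + (i + (k - i)) * p := by
        rw [Term.weight_iterate w hwA, Term.weight_iterate w hwB]; ring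
    _ = x := by rw [hi, mul_comm, ← hk]; omega

theorem zero_or_many_of_weightless_unary {σ : Type} {ar w : σ → ℕ} {f : σ}
    (hf : ar f = 1) (hwf : w f = 0) (N x : ℕ) :
    (∀ t : Term σ ar, Term.weight w t ≠ x) ∨
      ∃ F : Fin (N + 1) → Term σ ar, Function.Injective F ∧
        ∀ i, Term.weight w (F i) = x := by
  classical
  by_cases hS : ∃ t : Term σ ar, Term.weight w t = x
  swap
  · exact .inl fun t ht => hS ⟨t, ht⟩
  obtain ⟨t, ht⟩ := hS
  have hcount : ∀ n, Term.count f ((Term.diag f)^[n] t) = n + Term.count f t := by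
    intro n
    induction n with
    | zero => simp
    | succ n ih =>
      rw [Function.iterate_succ_apply', Term.diag, Term.count]
      simp [hf, ih]
      ring
  refine .inr ⟨fun i => (Term.diag f)^[i] t, fun i j h => ?_, fun i => ?_⟩
  · have h := congrArg (Term.count f) h
    simp only [hcount] at h
    omega
  · rw [Term.weight_iterate w (Term.weight_diag w hf), ht, hwf, mul_zero, add_zero]

theorem zero_or_many_terms_of_weight {σ : Type} [Fintype σ] (ar w : σ → ℕ)
    (hconst : ∃ c, ar c = 0) (hw : IsWeightFn ar w)
    (hsig : (∃ b, 2 ≤ ar b) ∨ ∃ u v, u ≠ v ∧ ar u = 1 ∧ ar v = 1) :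
    ∃ N₁ N₂ : ℕ, ∀ N x : ℕ, N * N₁ + N₂ < x →
      (∀ t : Term σ ar, Term.weight w t ≠ x) ∨
      ∃ F : Fin (N + 1) → Term σ ar, Function.Injective F ∧
        ∀ i, Term.weight w (F i) = x := by
  by_cases h0 : ∃ f, ar f = 1 ∧ w f = 0
  · obtain ⟨f, hf, hwf⟩ := h0
    exact ⟨0, 0, fun N x _ => zero_or_many_of_weightless_unary hf hwf N x⟩
  rcases hsig with ⟨b, hb⟩ | ⟨u, v, huv, hu, hv⟩
  · obtain ⟨c, hc⟩ := hconst
    have : IsEmpty (Fin (ar c)) := by rw [hc]; infer_instance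
    let s : Term σ ar := .mk c isEmptyElim
    have hs : Term.weight w s = w c := by simp [s, Term.weight]
    have hp : 0 < w b + (ar b - 1) * Term.weight w s := by
      rw [hs]
      exact Nat.add_pos_right _ (Nat.mul_pos (by omega) (hw.1 c hc))
    refine zero_or_many_of_transformations w hp
      (Term.weight_plug w b ⟨0, by omega⟩ s) (Term.weight_plug w b ⟨1, by omega⟩ s)
      (Term.plug_injective _ _ _) fun y z h => ?_
    simp only [Term.plug, Term.mk.injEq, heq_eq_eq, true_and] at h
    have h := congrFun h ⟨1, by omega⟩
    rw [Function.update_self, Function.update_of_ne (by simp)] at h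
    have hcb : c = b := (Term.mk.inj h).1
    rw [hcb] at hc
    omega
  · have hwu : 0 < w u := Nat.pos_of_ne_zero fun h => h0 ⟨u, hu, h⟩
    have hwv : 0 < w v := Nat.pos_of_ne_zero fun h => h0 ⟨v, hv, h⟩
    have hB := Term.weight_iterate w (Term.weight_diag w hv) (w u)
    rw [mul_comm] at hB
    refine zero_or_many_of_transformations w (Nat.mul_pos hwv hwu)
      (Term.weight_iterate w (Term.weight_diag w hu) (w v)) hB
      ((Term.diag_injective hu).iterate _) fun y z h => huv ?_
    obtain ⟨m, hm⟩ := Nat.exists_eq_succ_of_ne_zero hwu.ne'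
    obtain ⟨n, hn⟩ := Nat.exists_eq_succ_of_ne_zero hwv.ne'
    rw [hm, hn, Function.iterate_succ_apply', Function.iterate_succ_apply'] at h
    exact (Term.mk.inj h).1
end

section
/- Suppose Σ contains no unary function symbol of weight 0. Let W be the maximum weight of a symbol of Σ, A the maximum arity of a symbol of Σ, N₁ = W·A, and N₂ = W²·(A+1) + W. Then for all natural numbers N and x with x > N·N₁ + N₂, every ground term of weight x contains strictly more than N occurrences of nonconstant function symbols (symbols of arity ≥ 1). -/
theorem Term.sum_count_mk {σ : Type} [DecidableEq σ] {ar : σ → ℕ} (S : Finset σ) (h : σ)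
    (args : Fin (ar h) → Term σ ar) :
    ∑ g ∈ S, Term.count g (Term.mk h args) =
      (if h ∈ S then 1 else 0) + ∑ i, ∑ g ∈ S, Term.count g (args i) := by
  simp only [Term.count]
  rw [Finset.sum_add_distrib, Finset.sum_comm, Finset.sum_ite_eq]

theorem Term.weight_le_of_bounds {σ : Type} [Fintype σ] [DecidableEq σ] {ar w : σ → ℕ}
    {W A : ℕ} (hW : ∀ g, w g ≤ W) (hA : ∀ g, ar g ≤ A) (t : Term σ ar) :
    Term.weight w t ≤
      W + W * A * ∑ g ∈ Finset.univ.filter (fun g => 1 ≤ ar g), Term.count g t := by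
  induction t with
  | mk h args ih =>
    rw [Term.sum_count_mk, Term.weight]
    have hargs := Finset.sum_le_sum fun i (_ : i ∈ Finset.univ) => ih i
    rw [Finset.sum_add_distrib, ← Finset.mul_sum, Finset.sum_const, Finset.card_univ,
      Fintype.card_fin, smul_eq_mul] at hargs
    have hhead : ar h * W ≤ W * A * (if 1 ≤ ar h then 1 else 0) := by
      split_ifs with hpos
      · rw [mul_one, mul_comm]
        exact Nat.mul_le_mul_left W (hA h)
      · simp [Nat.lt_one_iff.mp (not_le.mp hpos)]
    simp only [Finset.mem_filter, Finset.mem_univ, true_and, mul_add]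
    linarith [hW h]

theorem many_nonconstant_occurrences {σ : Type} [Fintype σ] [DecidableEq σ]
    (ar w : σ → ℕ) (hconst : ∃ c, ar c = 0) (hw : IsWeightFn ar w)
    (hno : ∀ f, ar f = 1 → w f ≠ 0)
    (W A N₁ N₂ : ℕ) (hW : W = Finset.univ.sup w) (hA : A = Finset.univ.sup ar)
    (hN₁ : N₁ = W * A) (hN₂ : N₂ = W ^ 2 * (A + 1) + W)
    (N x : ℕ) (hx : N * N₁ + N₂ < x)
    (t : Term σ ar) (ht : Term.weight w t = x) :
    N < ∑ g ∈ Finset.univ.filter (fun g => 1 ≤ ar g), Term.count g t := by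
  subst ht hN₁ hN₂
  by_contra! hle
  have hbound := Term.weight_le_of_bounds (w := w) (W := W) (A := A)
    (fun g => hW ▸ Finset.le_sup (Finset.mem_univ g))
    (fun g => hA ▸ Finset.le_sup (Finset.mem_univ g)) t
  have hmul := Nat.mul_le_mul_left (W * A) hle
  have hcomm := mul_comm N (W * A)
  omega
end

section
/- Suppose Σ contains a unary function symbol g, a constant c, and a nonconstant function symbol h ≠ g of arity H, and that Σ contains no unary symbol of weight 0. Let k be a natural number with k > w(h) + w(c)·(H − 1), and let x = w(g)·k + w(c). Set M₁ = w(g), M₂ = k − w(h) − w(c)·(H − 1), and M₃ = w(g)·(H − 1) + 1. Then M₁, M₂, M₃ > 0 and there exists a ground term of weight x containing exactly M₁ occurrences of h, M₂ occurrences of g, M₃ occurrences of c, and no other symbols; in particular, there exists a ground term of weight x in which both g and h occur. -/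
theorem Fin.sum_comp_update_const {α : Type*} {n : ℕ} (i : Fin n) (a b : α) (f : α → ℕ) :
    ∑ j, f (Function.update (fun _ => b) i a j) = f a + (n - 1) * f b := by
  rw [Fintype.sum_eq_add_sum_compl i, Function.update_self]
  congr 1
  rw [Finset.sum_congr rfl (g := fun _ => f b) fun j hj => by
    rw [Function.update_of_ne (by simpa using hj)]]
  simp [Finset.card_compl]

/-- Stacking `n` copies of the unary symbol `g` on top of a term. -/
theorem Term.exists_stack_unary {σ : Type} [DecidableEq σ] {ar : σ → ℕ} (w : σ → ℕ) {g : σ}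
    (hg : ar g = 1) (s : Term σ ar) (n : ℕ) :
    ∃ t : Term σ ar, t.weight w = n * w g + s.weight w ∧
      ∀ e, t.count e = (if g = e then n else 0) + s.count e := by
  induction n with
  | zero => exact ⟨s, by simp, by simp⟩
  | succ n ih =>
    obtain ⟨t, htw, htc⟩ := ih
    refine ⟨.mk g fun _ => t, ?_, fun e => ?_⟩
    · simp only [Term.weight, Finset.sum_const, Finset.card_univ, Fintype.card_fin, hg, htw]
      simp only [smul_eq_mul]
      ring
    · simp only [Term.count, Finset.sum_const, Finset.card_univ, Fintype.card_fin, hg, htc]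
      split_ifs <;> simp only [smul_eq_mul] <;> ring

/-- Nesting `m` copies of `h` around the constant `c`, with all other arguments equal to `c`. -/
theorem Term.exists_nest_const {σ : Type} [DecidableEq σ] {ar : σ → ℕ} (w : σ → ℕ) {h c : σ}
    (hc : ar c = 0) (hh : 1 ≤ ar h) (m : ℕ) :
    ∃ t : Term σ ar, t.weight w = m * w h + (m * (ar h - 1) + 1) * w c ∧
      ∀ e, t.count e =
        (if h = e then m else 0) + (if c = e then m * (ar h - 1) + 1 else 0) := by
  have : IsEmpty (Fin (ar c)) := by rw [hc]; infer_instance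
  let s : Term σ ar := .mk c isEmptyElim
  have hsw : s.weight w = w c := by simp [s, Term.weight]
  have hsc (e : σ) : s.count e = if c = e then 1 else 0 := by simp [s, Term.count]
  induction m with
  | zero => exact ⟨s, by simp [hsw], by simp [hsc]⟩
  | succ m ih =>
    obtain ⟨t, htw, htc⟩ := ih
    refine ⟨.mk h (Function.update (fun _ => s) ⟨0, hh⟩ t), ?_, fun e => ?_⟩
    · rw [Term.weight, Fin.sum_comp_update_const _ _ _ (Term.weight w), htw, hsw]
      ring
    · rw [Term.count, Fin.sum_comp_update_const _ _ _ (Term.count e), htc, hsc]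
      split_ifs <;> ring

theorem term_with_g_and_h {σ : Type} [Fintype σ] [DecidableEq σ]
    (ar w : σ → ℕ) (hconstants : ∃ a, ar a = 0) (hw : IsWeightFn ar w)
    (hno : ∀ f, ar f = 1 → w f ≠ 0)
    (g c h : σ) (hg : ar g = 1) (hc : ar c = 0) (hh : 1 ≤ ar h) (hgh : h ≠ g)
    (H k x M₁ M₂ M₃ : ℕ) (hH : H = ar h)
    (hk : w h + w c * (H - 1) < k) (hx : x = w g * k + w c)
    (hM₁ : M₁ = w g) (hM₂ : M₂ = k - w h - w c * (H - 1))
    (hM₃ : M₃ = w g * (H - 1) + 1) :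
    0 < M₁ ∧ 0 < M₂ ∧ 0 < M₃ ∧
    ∃ t : Term σ ar, Term.weight w t = x ∧ Term.count h t = M₁ ∧
      Term.count g t = M₂ ∧ Term.count c t = M₃ ∧
      ∀ g', g' ≠ h → g' ≠ g → g' ≠ c → Term.count g' t = 0 := by
  subst hH hx hM₁ hM₂ hM₃
  have hch : c ≠ h := by rintro rfl; omega
  have hcg : c ≠ g := by rintro rfl; omega
  refine ⟨Nat.pos_of_ne_zero (hno g hg), by omega, by omega, ?_⟩
  obtain ⟨s, hsw, hsc⟩ := Term.exists_nest_const w hc hh (w g)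
  obtain ⟨t, htw, htc⟩ := Term.exists_stack_unary w hg s (k - w h - w c * (ar h - 1))
  refine ⟨t, ?_, ?_, ?_, ?_, fun e heh heg hec => ?_⟩
  · obtain ⟨d, rfl⟩ := Nat.exists_eq_add_of_lt hk
    have hd : w h + w c * (ar h - 1) + d + 1 - w h - w c * (ar h - 1) = d + 1 := by omega
    rw [htw, hsw, hd]
    ring
  · simp [htc, hsc, hgh.symm, hch]
  · simp [htc, hsc, hgh, hcg]
  · simp [htc, hsc, hch.symm, hcg.symm]
  · simp [htc, hsc, heh.symm, heg.symm, hec.symm]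
end

section
/- Let t₁,…,tₙ be pairwise distinct ground terms all having the same depth, and let Con be the contents of some ground term such that Con extends the contents of each tᵢ (1 ≤ i ≤ n). Then there exist at least n pairwise distinct ground terms with contents Con. -/
namespace Term

variable {σ : Type} {ar : σ → ℕ}

/-- The multiset of symbol occurrences of a term. -/
def symbols : Term σ ar → Multiset σ
  | .mk g args => g ::ₘ ∑ i, symbols (args i)

/-- The leftmost constant of a term. -/
def leftmost : Term σ ar → Term σ ar
  | .mk g args => if h : 0 < ar g then leftmost (args ⟨0, h⟩) else .mk g args

/-- Replaces every subterm at level `n` below the root by its leftmost constant. -/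
def trunc : ℕ → Term σ ar → Term σ ar
  | 0, t => t.leftmost
  | n + 1, .mk g args => .mk g fun i => trunc n (args i)

theorem count_symbols [DecidableEq σ] (a : σ) (t : Term σ ar) :
    t.symbols.count a = t.count a := by
  induction t with
  | mk g args ih =>
    simp only [symbols, count, Multiset.count_cons, Multiset.count_sum', ih, eq_comm (a := a)]
    exact add_comm _ _

theorem card_symbols (t : Term σ ar) :
    t.symbols.card = (t.symbols.map ar).sum + 1 := by
  induction t with
  | mk g args ih =>
    have hmap : ((∑ i, (args i).symbols).map ar).sum = ∑ i, ((args i).symbols.map ar).sum := by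
      rw [← Multiset.coe_mapAddMonoidHom, map_sum, ← Multiset.coe_sumAddMonoidHom, map_sum]
    simp only [symbols, Multiset.card_cons, Multiset.card_sum, ih, Multiset.map_cons,
      Multiset.sum_cons, hmap, Finset.sum_add_distrib, Finset.sum_const, Finset.card_univ,
      Fintype.card_fin, smul_eq_mul, mul_one]
    omega

theorem depth_pos (t : Term σ ar) : 0 < t.depth := by
  cases t
  simp [depth]

theorem depth_mk_le {g : σ} {args : Fin (ar g) → Term σ ar} {n : ℕ} :
    (mk g args).depth ≤ n + 1 ↔ ∀ i, (args i).depth ≤ n := by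
  simp [depth, add_comm 1]

theorem trunc_of_depth_le {n : ℕ} {t : Term σ ar} (h : t.depth ≤ n + 1) : t.trunc n = t := by
  induction n generalizing t with
  | zero =>
    obtain ⟨g, args⟩ := t
    rw [depth_mk_le] at h
    have hg : ¬ 0 < ar g := fun h0 => (depth_pos (args ⟨0, h0⟩)).not_ge (h _)
    simp [trunc, leftmost, hg]
  | succ n ih =>
    obtain ⟨g, args⟩ := t
    rw [depth_mk_le] at h
    simp only [trunc, ih (h _)]

/-- A multiset of constants is the multiset of symbols of a list of terms. -/
theorem exists_list_of_constants (C : Multiset σ) (hC : ∀ a ∈ C, ar a = 0) :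
    ∃ L : List (Term σ ar), L.length = C.card ∧ (L.map symbols).sum = C := by
  induction C using Multiset.induction with
  | empty => exact ⟨[], by simp⟩
  | cons a C ih =>
    obtain ⟨L, hlen, hsum⟩ := ih fun b hb => hC b (Multiset.mem_cons_of_mem hb)
    have ha : ar a = 0 := hC a (Multiset.mem_cons_self a C)
    have : IsEmpty (Fin (ar a)) := by rw [ha]; infer_instance
    refine ⟨mk a isEmptyElim :: L, by simp [hlen], ?_⟩
    simp [symbols, hsum]

/-- Among symbols with balanced arities, those of arity `0` suffice to fill all but one of the
argument places of any other symbol. -/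
theorem arity_le_card_constants {f : σ} {R : Multiset σ}
    (h : ((f ::ₘ R).map ar).sum = (f ::ₘ R).card) :
    ar f ≤ (R.filter (ar · = 0)).card + 1 := by
  have hle : (R.filter (¬ ar · = 0)).card ≤ (R.map ar).sum := by
    clear h
    induction R using Multiset.induction with
    | empty => simp
    | cons a R ih =>
      by_cases ha : ar a = 0
      · simpa [ha] using ih
      · simp only [ha, not_false_eq_true, Multiset.filter_cons_of_pos, Multiset.card_cons,
          Multiset.map_cons, Multiset.sum_cons]
        omega
  have hcard := congrArg Multiset.card (Multiset.filter_add_not (ar · = 0) R)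
  simp only [Multiset.card_add, Multiset.map_cons, Multiset.sum_cons, Multiset.card_cons] at *
  omega

theorem exists_leftmost_eq_symbols_add (R : Multiset σ) (hR : (R.map ar).sum = R.card)
    (s : Term σ ar) :
    ∃ s' : Term σ ar,
      s'.leftmost = s.leftmost ∧ s'.symbols = s.symbols + R := by
  induction hn : R.card using Nat.strong_induction_on generalizing R s with
  | _ n ih =>
  by_cases h0 : R = 0
  · exact ⟨s, rfl, by simp [h0]⟩
  obtain ⟨f, hf, hf0⟩ : ∃ f ∈ R, 0 < ar f := by
    by_contra! hall
    have : (R.map ar).sum = 0 := by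
      simpa [Multiset.sum_eq_zero_iff] using hall
    exact h0 (Multiset.card_eq_zero.mp (hR.symm.trans this))
  obtain ⟨R, rfl⟩ := Multiset.exists_cons_of_mem hf
  obtain ⟨C, hCmem⟩ := Multiset.card_pos_iff_exists_mem.mp <|
    (Nat.choose_pos (Nat.sub_le_of_le_add (arity_le_card_constants hR))).trans_eq
      (Multiset.card_powersetCard _ _).symm
  obtain ⟨hCR, hCcard⟩ := Multiset.mem_powersetCard.mp hCmem
  have hC : ∀ a ∈ C, ar a = 0 := fun a ha =>
    (Multiset.mem_filter.mp (Multiset.mem_of_le hCR ha)).2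
  obtain ⟨R, rfl⟩ := Multiset.le_iff_exists_add.mp (hCR.trans (Multiset.filter_le _ _))
  obtain ⟨L, hlen, hsum⟩ := exists_list_of_constants C hC
  have hL : ar f = (s :: L).length := by
    rw [List.length_cons]
    omega
  have hCsum : (C.map ar).sum = 0 := by
    simpa [Multiset.sum_eq_zero_iff] using hC
  simp only [Multiset.map_cons, Multiset.map_add, Multiset.sum_cons, Multiset.sum_add,
    Multiset.card_cons, Multiset.card_add] at hR hn
  obtain ⟨s', hleft, hsymb⟩ := ih R.card (by omega) R (by omega)
    (mk f fun i => (s :: L).get (i.cast hL)) rfl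
  refine ⟨s', ?_, ?_⟩
  · simpa [leftmost, hf0] using hleft
  · have hargs : ∑ i : Fin (ar f), ((s :: L).get (i.cast hL)).symbols = s.symbols + C := by
      refine ((finCongr hL).sum_comp fun j => ((s :: L).get j).symbols).trans ?_
      rw [← hsum, ← List.sum_cons, ← List.map_cons, ← List.sum_ofFn]
      exact congrArg List.sum (List.ofFn_getElem_eq_map (s :: L) symbols)
    rw [hsymb, symbols, hargs, ← Multiset.singleton_add, ← Multiset.singleton_add f]
    abel

theorem exists_trunc_eq_symbols_add (R : Multiset σ) (hR : (R.map ar).sum = R.card)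
    {n : ℕ} {t : Term σ ar} (ht : t.depth = n + 1) :
    ∃ s : Term σ ar, s.trunc n = t ∧ s.symbols = t.symbols + R := by
  induction n generalizing t with
  | zero =>
    obtain ⟨s, hleft, hsymb⟩ := exists_leftmost_eq_symbols_add R hR t
    exact ⟨s, hleft.trans (trunc_of_depth_le ht.le), hsymb⟩
  | succ n ih =>
    obtain ⟨g, args⟩ := t
    have hle := depth_mk_le.mp ht.le
    obtain ⟨i, hi⟩ : ∃ i, (args i).depth = n + 1 := by
      by_contra! hne
      have := depth_mk_le.mpr fun i => Nat.le_of_lt_succ ((hle i).lt_of_ne (hne i))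
      omega
    obtain ⟨s, htrunc, hsymb⟩ := ih hi
    refine ⟨mk g (Function.update args i s), ?_, ?_⟩
    · rw [trunc]
      congr 1
      ext j
      obtain rfl | hj := eq_or_ne j i
      · simpa using htrunc
      · simpa [hj] using trunc_of_depth_le (hle j)
    · have hupd : (fun j => (Function.update args i s j).symbols) =
          Function.update (fun j => (args j).symbols) i s.symbols :=
        Function.comp_update symbols args i s
      simp only [symbols, hupd, Finset.sum_update_of_mem (Finset.mem_univ i), hsymb,
        Multiset.cons_add]
      rw [← Finset.add_sum_erase _ _ (Finset.mem_univ i), Finset.sdiff_singleton_eq_erase]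
      congr 1
      abel

end Term

theorem extended_contents_many_terms {σ : Type} [DecidableEq σ] (ar : σ → ℕ)
    (n : ℕ) (t : Fin n → Term σ ar) (hinj : Function.Injective t)
    (d : ℕ) (hdepth : ∀ i, Term.depth (t i) = d)
    (ν : σ → ℕ) (t₀ : Term σ ar) (hν : ∀ g, Term.count g t₀ = ν g)
    (hext : ∀ i g, Term.count g (t i) ≤ ν g) :
    ∃ F : Fin n → Term σ ar, Function.Injective F ∧
      ∀ i g, Term.count g (F i) = ν g := by
  have hfill : ∀ i, ∃ s : Term σ ar, s.trunc (d - 1) = t i ∧ s.symbols = t₀.symbols := by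
    intro i
    have hle : (t i).symbols ≤ t₀.symbols := Multiset.le_iff_count.mpr fun a => by
      simpa only [Term.count_symbols, hν] using hext i a
    obtain ⟨R, hR⟩ := Multiset.le_iff_exists_add.mp hle
    have hbal : (R.map ar).sum = R.card := by
      have h₀ := t₀.card_symbols
      have h₁ := (t i).card_symbols
      rw [hR, Multiset.card_add, Multiset.map_add, Multiset.sum_add] at h₀
      omega
    have hd : (t i).depth = d - 1 + 1 := by
      have := (t i).depth_pos
      have := hdepth i
      omega
    rw [hR]
    exact Term.exists_trunc_eq_symbols_add R hbal hd
  choose F htrunc hsymb using hfill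
  refine ⟨F, fun i j hij => hinj ?_, fun i g => ?_⟩
  · rw [← htrunc i, hij, htrunc j]
  · rw [← Term.count_symbols, hsymb, Term.count_symbols, hν]
end
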